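/- arXiv:1309.0252 — 3 statements merged into one kernel-verified Lean document; each statement's English description precedes it below -/
import Mathlib

section
/- Let G be a finite connected simple graph that contains at least one cycle (i.e., G is not a tree) and is not isomorphic to any cycle graph C_n. Then the girth of G satisfies g(G) ≤ 2·res(G) − 1. -/
open SimpleGraph

/-- A set `S` of vertices is a resolving set of `G` if every pair of distinct vertices
`x, y` is resolved by some vertex `u ∈ S`, i.e. `d(u,x) ≠ d(u,y)`. -/
def IsResolvingSet {V : Type*} (G : SimpleGraph V) (S : Set V) : Prop :=
  ∀ x y : V, x ≠ y → ∃ u ∈ S, G.dist u x ≠ G.dist u y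

/-- The resolving number of `G`: the minimum `k` such that every `k`-element subset of the
vertex set is a resolving set of `G`. -/
noncomputable def resolvingNumber {V : Type*} [Fintype V] (G : SimpleGraph V) : ℕ :=
  sInf {k | ∀ S : Finset V, S.card = k → IsResolvingSet G ↑S}

namespace SimpleGraph

variable {V : Type*} {G : SimpleGraph V}

/-- A path whose length is at most half the girth is a geodesic. -/
theorem Walk.IsPath.dist_eq_length {u v : V} {p : G.Walk u v} (hp : p.IsPath)
    (h : 2 * p.length ≤ G.girth) : G.dist u v = p.length := by
  by_contra hne
  have hlt : G.dist u v < p.length := lt_of_le_of_ne (dist_le p) hne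
  obtain ⟨q, hq, hql⟩ := p.reachable.exists_path_of_dist
  let H : SimpleGraph V := fromEdgeSet {e | e ∈ p.edges ∨ e ∈ q.edges}
  have hle : H ≤ G := by
    rw [fromEdgeSet_le]
    rintro e ⟨he | he, -⟩
    · exact p.edges_subset_edgeSet he
    · exact q.edges_subset_edgeSet he
  have hpH : ∀ e ∈ p.edges, e ∈ H.edgeSet := fun e he => by
    rw [edgeSet_fromEdgeSet]
    exact ⟨Or.inl he, G.not_isDiag_of_mem_edgeSet (p.edges_subset_edgeSet he)⟩
  have hqH : ∀ e ∈ q.edges, e ∈ H.edgeSet := fun e he => by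
    rw [edgeSet_fromEdgeSet]
    exact ⟨Or.inr he, G.not_isDiag_of_mem_edgeSet (q.edges_subset_edgeSet he)⟩
  have hH : ¬ H.IsAcyclic := fun hac => by
    have heq := (hac.subsingleton_path u v).elim ⟨p.transfer H hpH, hp.transfer hpH⟩
      ⟨q.transfer H hqH, hq.transfer hqH⟩
    have hlen := congrArg (fun r : H.Path u v => r.1.length) heq
    simp only [Walk.length_transfer] at hlen
    omega
  simp only [IsAcyclic, not_forall, not_not] at hH
  obtain ⟨a, c, hc⟩ := hH
  have hgirth := girth_le_length (hc.mapLe hle)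
  have hsub : c.edges ⊆ p.edges ++ q.edges := fun e he => by
    have := c.edges_subset_edgeSet he
    rw [edgeSet_fromEdgeSet] at this
    exact List.mem_append.2 this.1
  have hlen := (hc.edges_nodup.subperm hsub).length_le
  simp only [Walk.length_mapLe, List.length_append, Walk.length_edges] at hgirth hlen
  omega

/-- A connected graph is a cycle graph as soon as it has a cycle whose vertices have no
neighbours besides those along the cycle. -/
theorem Walk.IsCycle.nonempty_iso_cycleGraph {u : V} {c : G.Walk u u} (hc : c.IsCycle)
    (hG : G.Connected) (h : ∀ x ∈ c.support, ∀ y, G.Adj x y → c.toSubgraph.Adj x y) :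
    Nonempty (G ≃g cycleGraph c.length) := by
  have hlen := hc.three_le_length
  have hsupp : ∀ x, x ∈ c.support := fun x => by
    obtain ⟨w⟩ := hG.preconnected u x
    induction w using Walk.concatRec with
    | Hnil => exact c.start_mem_support
    | Hconcat w hadj ih => exact c.mem_support_of_adj_toSubgraph (h _ (ih hc h hlen) _ hadj).symm
  have hinj : ∀ i j, i < c.length → j < c.length → c.getVert i = c.getVert j → i = j :=
    fun i j hi hj hij => hc.getVert_injOn' (by simp; omega) (by simp; omega) hij
  have hadj : ∀ i j, i < c.length → j < c.length →
      (G.Adj (c.getVert i) (c.getVert j) ↔ (c.length - j + i) % c.length = 1 ∨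
        (c.length - i + j) % c.length = 1) := by
    have hmod : ∀ i j, i < c.length → j < c.length →
        ((c.length - j + i) % c.length = 1 ↔ i = j + 1 ∨ i = 0 ∧ j + 1 = c.length) := by
      intro i j hi hj
      rcases lt_or_ge i j with hij | hij
      · rw [Nat.mod_eq_of_lt (by omega)]
        omega
      · rw [Nat.mod_eq_sub_mod (by omega), Nat.mod_eq_of_lt (by omega)]
        omega
    have hsucc : ∀ i j k, i < c.length → j < c.length → k < c.length →
        c.getVert k = c.getVert j → c.getVert (k + 1) = c.getVert i →
        i = j + 1 ∨ i = 0 ∧ j + 1 = c.length := by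
      intro i j k hi hj hk hkj hki
      obtain rfl := hinj k j hk hj hkj
      rcases lt_or_eq_of_le (show k + 1 ≤ c.length from hk) with hk' | hk'
      · exact Or.inl (hinj _ _ hk' hi hki).symm
      · refine Or.inr ⟨hinj _ _ hi (by omega) ?_, hk'⟩
        rw [← hki, hk', c.getVert_length, c.getVert_zero]
    have hstep : ∀ i j, j < c.length → (i = j + 1 ∨ i = 0 ∧ j + 1 = c.length) →
        G.Adj (c.getVert j) (c.getVert i) := by
      rintro i j hj (rfl | ⟨rfl, hj'⟩)
      · exact c.adj_getVert_succ hj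
      · rw [c.getVert_zero]
        have := c.adj_getVert_succ hj
        rwa [hj', c.getVert_length] at this
    intro i j hi hj
    rw [hmod i j hi hj, hmod j i hj hi]
    refine ⟨fun hij => ?_, ?_⟩
    · obtain ⟨k, hk, hkl⟩ :=
        c.toSubgraph_adj_iff.1 (h _ (hsupp _) _ hij)
      rcases Sym2.eq_iff.1 hk with ⟨h1, h2⟩ | ⟨h1, h2⟩
      · exact Or.inr (hsucc j i k hj hi hkl h1 h2)
      · exact Or.inl (hsucc i j k hi hj hkl h1 h2)
    · rintro (hij | hij)
      · exact (hstep i j hj hij).symm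
      · exact hstep j i hi hij
  let f : Fin c.length → V := fun i => c.getVert i
  have hf : Function.Bijective f := by
    refine ⟨fun i j hij => Fin.ext (hinj i j i.2 j.2 hij), fun x => ?_⟩
    obtain ⟨i, rfl, hi⟩ := Walk.mem_support_iff_exists_getVert.1 (hsupp x)
    rcases hi.lt_or_eq with hi | rfl
    · exact ⟨⟨i, hi⟩, rfl⟩
    · exact ⟨⟨0, by omega⟩, by simp [f]⟩
  refine ⟨(RelIso.mk (Equiv.ofBijective f hf) ?_).symm⟩
  intro i j
  rw [cycleGraph_adj', Fin.val_sub, Fin.val_sub]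
  exact hadj i j i.2 j.2

/-- A connected graph containing a cycle that is not a cycle graph has a vertex on some cycle
with a neighbour which is not one of its two neighbours on the cycle. -/
theorem Connected.exists_isCycle_adj_ne (hG : G.Connected) (hcyc : ¬ G.IsAcyclic)
    (hncycle : ¬ ∃ n : ℕ, Nonempty (G ≃g cycleGraph n)) :
    ∃ (v w : V) (c : G.Walk v v), c.IsCycle ∧ G.Adj v w ∧ w ≠ c.snd ∧ w ≠ c.penultimate := by
  classical
  simp only [IsAcyclic, not_forall, not_not] at hcyc
  obtain ⟨u, c, hc⟩ := hcyc
  by_contra! hno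
  refine hncycle ⟨_, hc.nonempty_iso_cycleGraph hG fun x hx y hxy => ?_⟩
  have hr := hc.rotate hx
  rw [← c.toSubgraph_rotate hx, ← Subgraph.mem_neighborSet, hr.neighborSet_toSubgraph_endpoint]
  by_cases hy : y = (c.rotate x hx).snd
  · exact Or.inl hy
  · exact Or.inr (hno x y _ hr hxy hy)

/-- Adding a further neighbour `w` of the start of a geodesically short path at its start yields
a geodesic, provided `w` is not the second vertex of the path. -/
theorem Walk.IsPath.dist_getVert_of_adj {v x w : V} {p : G.Walk v x} (hp : p.IsPath)
    (hadj : G.Adj w v) (hw : w ≠ p.snd) {i : ℕ} (hi : i ≤ p.length)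
    (h : 2 * (i + 1) ≤ G.girth) : G.dist w (p.getVert i) = i + 1 := by
  have hlen : (p.take i).length = i := by simp [hi]
  have hnot : w ∉ (p.take i).support := fun hmem => by
    obtain ⟨j, hj, hji⟩ := Walk.mem_support_iff_exists_getVert.1 hmem
    rw [hlen] at hji
    rw [take_getVert, min_eq_right hji] at hj
    have hjl : (p.take j).length = j := by simp; omega
    have hd := (hp.take j).dist_eq_length (by omega)
    rw [hjl, hj, dist_eq_one_iff_adj.2 hadj.symm] at hd
    exact hw (by rw [← hj, ← hd])
  have := ((hp.take i).cons hnot (h := hadj)).dist_eq_length (by simp [hi]; omega)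
  simpa [hi] using this

end SimpleGraph

/-- Any set of vertices equidistant from two distinct vertices has fewer elements than the
resolving number. -/
theorem card_lt_resolvingNumber {V : Type*} [Fintype V] {G : SimpleGraph V} {x y : V}
    (hxy : x ≠ y) (S : Finset V) (hS : ∀ u ∈ S, G.dist u x = G.dist u y) :
    S.card < resolvingNumber G := by
  have hne : {k | ∀ S : Finset V, S.card = k → IsResolvingSet G ↑S}.Nonempty :=
    ⟨Fintype.card V + 1, fun T hT => absurd T.card_le_univ (by omega)⟩
  by_contra! hle
  obtain ⟨T, hTS, hT⟩ := Finset.exists_subset_card_eq hle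
  obtain ⟨u, hu, hdist⟩ := Nat.sInf_mem hne T hT x y hxy
  exact hdist (hS u (hTS hu))

/-- If G contains a cycle and is not a cycle graph, then g(G) ≤ 2·res(G) − 1. -/
theorem stmt5 {V : Type*} [Fintype V] (G : SimpleGraph V) (hG : G.Connected)
    (hcyc : ¬ G.IsAcyclic)
    (hncycle : ¬ ∃ n : ℕ, Nonempty (G ≃g cycleGraph n)) :
    G.girth ≤ 2 * resolvingNumber G - 1 := by
  classical
  obtain ⟨v, w, c, hc, hvw, hw1, hw2⟩ := hG.exists_isCycle_adj_ne hcyc hncycle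
  have hlen := hc.three_le_length
  have hgirth := girth_le_length hc
  have hp := hc.isPath_tail.reverse
  have hpl : c.tail.reverse.length + 1 = c.length := by
    rw [Walk.length_reverse, Walk.length_tail_add_one hc.not_nil]
  have hsnd : c.tail.reverse.snd = c.penultimate := by
    rw [Walk.snd_reverse, Walk.penultimate, Walk.getVert_tail, Walk.penultimate]
    congr 1
    rw [Walk.length_reverse] at hpl
    omega
  have hx : ∀ i < G.girth / 2, G.dist w (c.tail.reverse.getVert i) = i + 1 := fun i hi =>
    hp.dist_getVert_of_adj hvw.symm (hsnd ▸ hw2) (by omega) (by omega)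
  have hy : ∀ i < G.girth / 2, G.dist c.snd (c.tail.reverse.getVert i) = i + 1 := fun i hi =>
    hp.dist_getVert_of_adj (c.adj_snd hc.not_nil).symm (hsnd ▸ hc.snd_ne_penultimate)
      (by omega) (by omega)
  have hcard : ((Finset.range (G.girth / 2)).image c.tail.reverse.getVert).card
      = G.girth / 2 := by
    rw [Finset.card_image_of_injOn, Finset.card_range]
    refine hp.getVert_injOn.mono fun i hi => ?_
    simp at hi ⊢
    omega
  have := card_lt_resolvingNumber hw1
    ((Finset.range (G.girth / 2)).image c.tail.reverse.getVert) fun u hu => by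
      obtain ⟨i, hi, rfl⟩ := Finset.mem_image.1 hu
      rw [Finset.mem_range] at hi
      rw [dist_comm, hx i hi, dist_comm, hy i hi]
  omega
end

section
/- Let G be a finite connected simple graph on n vertices that is not isomorphic to any path graph and not isomorphic to any cycle graph. If the girth of G is strictly greater than 5 (possibly infinite) and the maximum degree Δ(G) equals 3, then n ≤ 6·res(G) − 8. -/
open SimpleGraph

/-- The vertices equidistant from two distinct vertices do not resolve them, so there are fewer
of them than the resolving number. -/
theorem card_equidistant_lt_resolvingNumber {V : Type*} [Fintype V] (G : SimpleGraph V)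
    {x y : V} (hxy : x ≠ y) :
    (Finset.univ.filter fun u => G.dist u x = G.dist u y).card < resolvingNumber G := by
  have hmem : resolvingNumber G ∈
      {k | ∀ S : Finset V, S.card = k → IsResolvingSet G (S : Set V)} :=
    Nat.sInf_mem ⟨Fintype.card V + 1, fun S hS => by
      have := S.card_le_univ
      omega⟩
  by_contra! h
  obtain ⟨S, hS, hcard⟩ := Finset.exists_subset_card_eq h
  obtain ⟨u, hu, hne⟩ := hmem S hcard x y hxy
  exact hne (Finset.mem_filter.1 (hS hu)).2

/-- Every vertex `u` is equidistant from some pair among a vertex and three of its neighbours: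
the distances from `u` to these four vertices take at most three values. -/
theorem card_add_eight_le_of_three_neighbors {V : Type*} [Fintype V] (G : SimpleGraph V)
    (hG : G.Connected) {v a b c : V} (ha : G.Adj v a) (hb : G.Adj v b) (hc : G.Adj v c)
    (hab : a ≠ b) (hac : a ≠ c) (hbc : b ≠ c) :
    Fintype.card V + 8 ≤ 6 * resolvingNumber G := by
  classical
  have hva := card_equidistant_lt_resolvingNumber G ha.ne
  have hvb := card_equidistant_lt_resolvingNumber G hb.ne
  have hvc := card_equidistant_lt_resolvingNumber G hc.ne
  have hab' := card_equidistant_lt_resolvingNumber G hab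
  have hac' := card_equidistant_lt_resolvingNumber G hac
  have hbc' := card_equidistant_lt_resolvingNumber G hbc
  have near : ∀ u w, G.Adj v w → G.dist u w ≤ G.dist u v + 1 ∧ G.dist u v ≤ G.dist u w + 1 := by
    intro u w h
    have h₁ := hG.dist_triangle (u := u) (v := v) (w := w)
    have h₂ := hG.dist_triangle (u := u) (v := w) (w := v)
    rw [dist_eq_one_iff_adj.2 h] at h₁
    rw [dist_eq_one_iff_adj.2 h.symm] at h₂
    exact ⟨h₁, h₂⟩
  have key : ∑ u : V, (1 + if u = v then 2 else 0) ≤ ∑ u : V,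
      ((if G.dist u v = G.dist u a then 1 else 0) + (if G.dist u v = G.dist u b then 1 else 0) +
      (if G.dist u v = G.dist u c then 1 else 0) + (if G.dist u a = G.dist u b then 1 else 0) +
      (if G.dist u a = G.dist u c then 1 else 0) + (if G.dist u b = G.dist u c then 1 else 0)) := by
    refine Finset.sum_le_sum fun u _ => ?_
    by_cases huv : u = v
    · subst huv
      simp [dist_eq_one_iff_adj.2 ha, dist_eq_one_iff_adj.2 hb, dist_eq_one_iff_adj.2 hc]
    · have h₁ := near u a ha
      have h₂ := near u b hb
      have h₃ := near u c hc
      rw [if_neg huv]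
      split_ifs <;> omega
  simp only [Finset.sum_add_distrib, ← Finset.card_filter, Finset.sum_ite_eq', Finset.mem_univ,
    if_true, Finset.sum_const, Finset.card_univ, smul_eq_mul, mul_one] at key
  omega

theorem stmt15 {V : Type*} [Fintype V] (G : SimpleGraph V) [DecidableRel G.Adj]
    (hG : G.Connected)
    (hpath : ¬ ∃ n : ℕ, Nonempty (G ≃g pathGraph n))
    (hcycle : ¬ ∃ n : ℕ, Nonempty (G ≃g cycleGraph n))
    (hgirth : 5 < G.egirth) (hdeg : G.maxDegree = 3) :
    Fintype.card V ≤ 6 * resolvingNumber G - 8 := by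
  classical
  have : Nonempty V := hG.nonempty
  obtain ⟨v, hv⟩ := G.exists_maximal_degree_vertex
  rw [hdeg, ← G.card_neighborFinset_eq_degree] at hv
  obtain ⟨a, b, c, hab, hac, hbc, hN⟩ := Finset.card_eq_three.1 hv.symm
  have hadj : ∀ w, w ∈ ({a, b, c} : Finset V) → G.Adj v w := fun w hw =>
    (G.mem_neighborFinset v w).1 (hN ▸ hw)
  exact Nat.le_sub_of_add_le (card_add_eight_le_of_three_neighbors G hG
    (hadj a (by simp)) (hadj b (by simp)) (hadj c (by simp)) hab hac hbc)
end

section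
/- For every even integer n ≥ 4, the cycle graph C_n has resolving number res(C_n) = 3. -/
open SimpleGraph

theorem cycleGraph_adj_iff_val {n : ℕ} (hn : 2 ≤ n) {u v : Fin n} :
    (cycleGraph n).Adj u v ↔ u.val + 1 = v.val ∨ v.val + 1 = u.val ∨
      (u.val = 0 ∧ v.val + 1 = n) ∨ (v.val = 0 ∧ u.val + 1 = n) := by
  rw [cycleGraph_adj']
  have hu := u.isLt
  have hv := v.isLt
  rcases lt_trichotomy u v with h | h | h
  · rw [Fin.coe_sub_iff_lt.mpr h, Fin.coe_sub_iff_le.mpr h.le]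
    rw [Fin.lt_def] at h
    omega
  · subst h
    rw [Fin.coe_sub_iff_le.mpr le_rfl]
    omega
  · rw [Fin.coe_sub_iff_lt.mpr h, Fin.coe_sub_iff_le.mpr h.le]
    rw [Fin.lt_def] at h
    omega

theorem cycleGraph_min_le_walk_length {n : ℕ} (hn : 2 ≤ n) {u v : Fin n}
    (p : (cycleGraph n).Walk u v) :
    min (Nat.dist u v) (n - Nat.dist u v) ≤ p.length := by
  induction p with
  | nil => simp
  | @cons a b c h p ih =>
    rw [cycleGraph_adj_iff_val hn] at h
    rw [Walk.length_cons]
    have ha := a.isLt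
    have hb := b.isLt
    have hc := c.isLt
    unfold Nat.dist at *
    omega

theorem cycleGraph_connected_of_pos {n : ℕ} (hn : 0 < n) : (cycleGraph n).Connected := by
  obtain ⟨m, rfl⟩ := Nat.exists_eq_succ_of_ne_zero hn.ne'
  exact cycleGraph_connected

theorem cycleGraph_dist_le_sub {n : ℕ} (hn : 2 ≤ n) (k : ℕ) (u v : Fin n)
    (h : u.val + k = v.val) : (cycleGraph n).dist u v ≤ k := by
  induction k generalizing v with
  | zero =>
    obtain rfl : u = v := Fin.ext h
    simp
  | succ k ih =>
    let w : Fin n := ⟨u.val + k, by omega⟩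
    have hw : (cycleGraph n).Adj w v := (cycleGraph_adj_iff_val hn).mpr (Or.inl h)
    have ht := (cycleGraph_connected_of_pos (n := n) (by omega)).dist_triangle
      (u := u) (v := w) (w := v)
    have h1 := ih w rfl
    rw [dist_eq_one_iff_adj.mpr hw] at ht
    omega

theorem cycleGraph_dist_of_le {n : ℕ} (hn : 2 ≤ n) {u v : Fin n} (h : u ≤ v) :
    (cycleGraph n).dist u v = min (v.val - u.val) (n - (v.val - u.val)) := by
  have hc := cycleGraph_connected_of_pos (n := n) (by omega)
  have hv := v.isLt
  rw [Fin.le_def] at h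
  apply le_antisymm
  · let a : Fin n := ⟨0, by omega⟩
    let b : Fin n := ⟨n - 1, by omega⟩
    have hab : (cycleGraph n).Adj a b :=
      (cycleGraph_adj_iff_val hn).mpr
        (Or.inr (Or.inr (Or.inl ⟨rfl, show n - 1 + 1 = n by omega⟩)))
    have h1 := cycleGraph_dist_le_sub hn (v.val - u.val) u v (by omega)
    have h2 := cycleGraph_dist_le_sub hn u.val a u (by simp [a])
    have h3 := cycleGraph_dist_le_sub hn (n - 1 - v.val) v b
      (show v.val + (n - 1 - v.val) = n - 1 by omega)
    have h4 := hc.dist_triangle (u := u) (v := a) (w := v)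
    have h5 := hc.dist_triangle (u := a) (v := b) (w := v)
    rw [dist_eq_one_iff_adj.mpr hab, dist_comm (u := b)] at h5
    rw [dist_comm (u := u) (v := a)] at h4
    omega
  · obtain ⟨p, hp⟩ := hc.exists_walk_length_eq_dist u v
    have hl := cycleGraph_min_le_walk_length hn p
    rw [Nat.dist_eq_sub_of_le h] at hl
    omega

theorem cycleGraph_dist {n : ℕ} (hn : 2 ≤ n) (u v : Fin n) :
    (cycleGraph n).dist u v = min (Nat.dist u v) (n - Nat.dist u v) := by
  rcases le_total u v with h | h
  · rw [cycleGraph_dist_of_le hn h, Nat.dist_eq_sub_of_le h]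
  · rw [dist_comm, cycleGraph_dist_of_le hn h, Nat.dist_eq_sub_of_le_right h]

/-- A vertex equidistant from two distinct vertices of a cycle lies on their axis of symmetry. -/
theorem cycleGraph_two_mul_of_dist_eq {n : ℕ} (hn : 2 ≤ n) {u x y : Fin n} (hxy : x ≠ y)
    (h : (cycleGraph n).dist u x = (cycleGraph n).dist u y) :
    2 * u.val = x.val + y.val ∨ 2 * u.val = x.val + y.val + n ∨
      2 * u.val + n = x.val + y.val := by
  rw [cycleGraph_dist hn, cycleGraph_dist hn] at h
  have hu := u.isLt
  have hx := x.isLt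
  have hy := y.isLt
  have hne := Fin.val_ne_of_ne hxy
  unfold Nat.dist at h
  omega

theorem cycleGraph_isResolvingSet_of_card_eq_three {n : ℕ} {S : Finset (Fin n)}
    (hS : S.card = 3) : IsResolvingSet (cycleGraph n) (S : Set (Fin n)) := by
  intro x y hxy
  by_contra! hcon
  obtain ⟨a, b, c, hab, hac, hbc, rfl⟩ := Finset.card_eq_three.mp hS
  have hx := x.isLt
  have hy := y.isLt
  have hxy' := Fin.val_ne_of_ne hxy
  have hn : 2 ≤ n := by omega
  have h1 := cycleGraph_two_mul_of_dist_eq hn hxy (hcon a (by simp))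
  have h2 := cycleGraph_two_mul_of_dist_eq hn hxy (hcon b (by simp))
  have h3 := cycleGraph_two_mul_of_dist_eq hn hxy (hcon c (by simp))
  have := Fin.val_ne_of_ne hab
  have := Fin.val_ne_of_ne hac
  have := Fin.val_ne_of_ne hbc
  omega

theorem IsResolvingSet.mono {V : Type*} {G : SimpleGraph V} {S T : Set V} (hST : S ⊆ T)
    (hS : IsResolvingSet G S) : IsResolvingSet G T := fun x y hxy =>
  let ⟨u, hu, h⟩ := hS x y hxy
  ⟨u, hST hu, h⟩

theorem cycleGraph_not_isResolvingSet_antipodal {m : ℕ} (hm : 2 ≤ m) :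
    ¬ IsResolvingSet (cycleGraph (m + m))
      {(⟨0, by omega⟩ : Fin (m + m)), (⟨m, by omega⟩ : Fin (m + m))} := by
  intro h
  obtain ⟨u, hu, hne⟩ := h ⟨1, by omega⟩ ⟨m + m - 1, by omega⟩
    (by rw [ne_eq, Fin.mk.injEq]; omega)
  apply hne
  rw [cycleGraph_dist (by omega), cycleGraph_dist (by omega)]
  rcases hu with rfl | rfl <;> simp only [Nat.dist] <;> omega

theorem stmt19 (n : ℕ) (hn : 4 ≤ n) (he : Even n) :
    resolvingNumber (cycleGraph n) = 3 := by
  obtain ⟨m, rfl⟩ := he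
  apply le_antisymm
  · exact Nat.sInf_le fun S hS => cycleGraph_isResolvingSet_of_card_eq_three hS
  · refine le_csInf ⟨3, fun S hS => cycleGraph_isResolvingSet_of_card_eq_three hS⟩ fun k hk => ?_
    by_contra! hlt
    let T : Finset (Fin (m + m)) := {⟨0, by omega⟩, ⟨m, by omega⟩}
    have hT : T.card = 2 := Finset.card_pair (by rw [ne_eq, Fin.mk.injEq]; omega)
    obtain ⟨S, hST, hS⟩ := Finset.exists_subset_card_eq (s := T) (n := k) (by omega)
    apply cycleGraph_not_isResolvingSet_antipodal (m := m) (by omega)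
    refine (hk S hS).mono ?_
    simpa [T] using Finset.coe_subset.mpr hST
end
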